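/- Let (Ω, 𝔉, P) be a probability space and (𝒢_t)_{t≥0} a filtration with 𝒢_t ⊆ 𝔉 for all t. Let G : [0,∞) × Ω → ℝ be jointly measurable with E[∫₀^∞ |G(t)| dt] < ∞ and suppose t ↦ G(t) is continuous in L¹(P), i.e. E[|G(t′) − G(t)|] → 0 as t′ → t, for every t ≥ 0. Assume that for every t₀ ≥ 0, every h > 0, and every bounded 𝒢_{t₀}-measurable random variable α, one has E[ α · ∫_{t₀}^{t₀+h} G(t) dt ] = 0. Then for every t ≥ 0, the conditional expectation satisfies E[G(t) | 𝒢_t] = 0 P-almost surely. -/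

import Mathlib

open MeasureTheory Set

/-- If an integrable `f` is a.e. within `g` of a constant `c`, with `g → 0` at `t` from the right,
and all right-sided integrals of `f` starting at `t` vanish, then `c = 0`. -/
lemma eq_zero_of_forall_setIntegral_Ico_eq_zero {f g : ℝ → ℝ} {t c : ℝ}
    (hf : IntegrableOn f (Ici t))
    (hfg : ∀ᵐ s ∂volume.restrict (Ici t), |f s - c| ≤ g s)
    (hg : Filter.Tendsto g (nhdsWithin t (Ici t)) (nhds 0))
    (hzero : ∀ h : ℝ, 0 < h → ∫ s in Ico t (t + h), f s = 0) : c = 0 := by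
  by_contra hc
  have hc' : 0 < |c| := abs_pos.mpr hc
  have hev : ∀ᶠ s in nhdsWithin t (Ici t), g s < |c| / 2 :=
    hg.eventually (gt_mem_nhds (by positivity))
  obtain ⟨u, hu, hsub⟩ := mem_nhdsGE_iff_exists_Ico_subset.mp hev
  have hh : 0 < u - t := sub_pos.mpr hu
  have hz := hzero (u - t) hh
  rw [add_sub_cancel] at hz
  have hIci : Ico t u ⊆ Ici t := Ico_subset_Ici_self
  have hbound : ‖∫ s in Ico t u, (f s - c)‖ ≤ |c| / 2 * volume.real (Ico t u) := by
    refine norm_setIntegral_le_of_norm_le_const_ae (by simp) ?_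
    filter_upwards [ae_restrict_of_ae_restrict_of_subset hIci hfg,
      ae_restrict_mem measurableSet_Ico] with s hs hsm
    exact hs.trans (hsub hsm).le
  rw [integral_sub (hf.mono_set hIci) (integrableOn_const (by simp)), hz, setIntegral_const,
    zero_sub, norm_neg, smul_eq_mul, norm_mul, Real.volume_real_Ico_of_le hu.le, Real.norm_eq_abs,
    Real.norm_eq_abs, abs_of_pos hh] at hbound
  nlinarith

/-- Abstract core of the necessary maximum principle. If `G` is jointly
measurable, integrable on `[0,∞) × Ω`, continuous in `L¹(P)`, and
`E[α ∫_{t₀}^{t₀+h} G(t) dt] = 0` for all `t₀ ≥ 0`, `h > 0`, and bounded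
`𝒢_{t₀}`-measurable `α`, then `E[G(t) | 𝒢_t] = 0` a.s. for every `t ≥ 0`. -/
theorem stmt_4 {Ω : Type*} {m : MeasurableSpace Ω} (P : Measure Ω) [IsProbabilityMeasure P]
    (𝒢 : ℝ → MeasurableSpace Ω)
    (h𝒢mono : ∀ s t : ℝ, 0 ≤ s → s ≤ t → 𝒢 s ≤ 𝒢 t) (h𝒢le : ∀ t : ℝ, 𝒢 t ≤ m)
    (G : ℝ → Ω → ℝ)
    (hGmeas : Measurable (Function.uncurry G))
    (hGint : Integrable (Function.uncurry G) ((volume.restrict (Ici 0)).prod P))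
    (hGL1cont : ∀ t : ℝ, 0 ≤ t →
      Filter.Tendsto (fun t' : ℝ => ∫ ω, |G t' ω - G t ω| ∂P)
        (nhdsWithin t (Ici 0)) (nhds 0))
    (hperturb : ∀ t₀ : ℝ, 0 ≤ t₀ → ∀ h : ℝ, 0 < h → ∀ α : Ω → ℝ,
      Measurable[𝒢 t₀] α → (∃ C : ℝ, ∀ ω, |α ω| ≤ C) →
      ∫ ω, α ω * (∫ t in Ico t₀ (t₀ + h), G t ω) ∂P = 0) :
    ∀ t : ℝ, 0 ≤ t → P[G t | 𝒢 t] =ᵐ[P] 0 := by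
  intro t ht
  by_cases hGt : Integrable (G t) P
  swap
  · rw [condExp_of_not_integrable hGt]
  refine (ae_eq_condExp_of_forall_setIntegral_eq (h𝒢le t) hGt
    (fun _ _ _ => integrableOn_zero) ?_ aestronglyMeasurable_zero).symm
  intro A hA _
  have hAm : MeasurableSet A := h𝒢le t A hA
  have hIci : Ici t ⊆ Ici (0 : ℝ) := Ici_subset_Ici.mpr ht
  have hGA : Integrable (Function.uncurry G) ((volume.restrict (Ici t)).prod (P.restrict A)) :=
    hGint.mono_measure
      (Measure.prod_mono (Measure.restrict_mono_set _ hIci) Measure.restrict_le_self)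
  have hfg : ∀ᵐ s ∂volume.restrict (Ici t),
      |(∫ ω in A, G s ω ∂P) - ∫ ω in A, G t ω ∂P| ≤ ∫ ω, |G s ω - G t ω| ∂P := by
    filter_upwards [ae_restrict_of_ae_restrict_of_subset hIci hGint.prod_right_ae] with s hs
    have hs : Integrable (G s) P := hs
    rw [← integral_sub hs.integrableOn hGt.integrableOn]
    exact (abs_integral_le_integral_abs).trans
      (setIntegral_le_integral (hs.sub hGt).abs (ae_of_all _ fun _ => abs_nonneg _))
  have hzero : ∀ h : ℝ, 0 < h → ∫ s in Ico t (t + h), ∫ ω in A, G s ω ∂P = 0 := by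
    intro h hh
    have hα := hperturb t ht h hh (A.indicator 1) ((@measurable_one _ _ _ (𝒢 t) _).indicator hA)
      ⟨1, fun ω => by by_cases hω : ω ∈ A <;> simp [hω]⟩
    rw [integral_integral_swap (hGA.mono_measure
      (Measure.prod_mono (Measure.restrict_mono_set _ Ico_subset_Ici_self) le_rfl)),
      ← integral_indicator hAm, ← hα]
    congr 1 with ω
    by_cases hω : ω ∈ A <;> simp [hω]
  have := eq_zero_of_forall_setIntegral_Ico_eq_zero hGA.integral_prod_left hfg
    ((hGL1cont t ht).mono_left (nhdsWithin_mono _ hIci)) hzero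
  simp [this]
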